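/- There exists a (strictly) increasing function τ : (0,∞) → (0,∞) such that t < τ(t) < 2t for every t > 0 and V(t) = (t/τ(t)) · Φ_1(τ(t)) for every t > 0; equivalently, Φ(2t) − Φ(t) = t · φ(τ(t)) where φ(s) = ∑_j p_j e^{−s p_j}. In particular, V(t) → ∞ as t → ∞ if and only if Φ_1(t) → ∞ as t → ∞. -/

import Mathlib

open Filter Topology

/-- Poissonized expected number of occupied boxes. -/
noncomputable def Phi (p : ℕ → ℝ) (t : ℝ) : ℝ := ∑' j, (1 - Real.exp (-t * p j))

/-- Poissonized variance `V(t) = Φ(2t) − Φ(t)`. -/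
noncomputable def Vpois (p : ℕ → ℝ) (t : ℝ) : ℝ := Phi p (2 * t) - Phi p t

/-- `φ(t) = ∑_j p_j e^{-t p_j}`. -/
noncomputable def phi (p : ℕ → ℝ) (t : ℝ) : ℝ := ∑' j, p j * Real.exp (-t * p j)

/-- `Φ_1(t) = t ∑_j p_j e^{-t p_j}`. -/
noncomputable def Phi1 (p : ℕ → ℝ) (t : ℝ) : ℝ := t * ∑' j, p j * Real.exp (-t * p j)


lemma aux_summable (p : ℕ → ℝ) (hpos : ∀ j, 0 < p j) (hs : Summable p) (t : ℝ) (ht : 0 ≤ t) :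
    Summable (fun j => p j * Real.exp (-t * p j)) := by
  refine Summable.of_nonneg_of_le (fun j => ?_) (fun j => ?_) hs
  · have := hpos j
    positivity
  · have h1 : Real.exp (-t * p j) ≤ 1 := by
      apply Real.exp_le_one_iff.2
      have := mul_nonneg ht (hpos j).le
      linarith
    have := mul_le_mul_of_nonneg_left h1 (hpos j).le
    linarith

lemma aux_summable2 (p : ℕ → ℝ) (hpos : ∀ j, 0 < p j) (hs : Summable p) (t : ℝ) (ht : 0 ≤ t) :
    Summable (fun j => 1 - Real.exp (-t * p j)) := by
  refine Summable.of_nonneg_of_le (fun j => ?_) (fun j => ?_) (hs.mul_left t)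
  · have h1 : Real.exp (-t * p j) ≤ 1 := by
      apply Real.exp_le_one_iff.2
      have := mul_nonneg ht (hpos j).le
      linarith
    linarith
  · have := Real.add_one_le_exp (-t * p j)
    linarith

lemma aux_V (p : ℕ → ℝ) (hpos : ∀ j, 0 < p j) (hs : Summable p) (t : ℝ) (ht : 0 ≤ t) :
    HasSum (fun j => Real.exp (-t * p j) - Real.exp (-(2 * t) * p j)) (Vpois p t) := by
  have h := (aux_summable2 p hpos hs (2*t) (by linarith)).hasSum.sub
    (aux_summable2 p hpos hs t ht).hasSum
  have e : (fun j => Real.exp (-t * p j) - Real.exp (-(2 * t) * p j)) =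
      fun j => (1 - Real.exp (-(2 * t) * p j)) - (1 - Real.exp (-t * p j)) := by
    funext j
    ring
  rw [e]
  exact h

lemma aux_key {a b : ℝ} (ha : 0 < a) (hab : a < b) :
    a * (Real.exp (-b) - Real.exp (-(2*b))) < b * (Real.exp (-a) - Real.exp (-(2*a))) := by
  have hb : 0 < b := ha.trans hab
  have hc : Real.exp (-a) ≤ (1 - a/b) + (a/b) * Real.exp (-b) := by
    have h0 : 0 ≤ 1 - a / b := by
      rw [sub_nonneg, div_le_one hb]; exact hab.le
    have := convexOn_exp.2 (Set.mem_univ (0:ℝ)) (Set.mem_univ (-b)) h0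
      (by positivity : 0 ≤ a / b) (by ring)
    simp only [smul_eq_mul, Real.exp_zero, mul_zero, zero_add, mul_one] at this
    have e : a / b * -b = -a := by field_simp
    rwa [e] at this
  have hc2 : a * (1 - Real.exp (-b)) ≤ b * (1 - Real.exp (-a)) := by
    have := mul_le_mul_of_nonneg_left hc hb.le
    have e : b * ((1 - a/b) + (a/b) * Real.exp (-b)) = b - a + a * Real.exp (-b) := by
      field_simp
    linarith
  have e1 : Real.exp (-(2*a)) = Real.exp (-a) * Real.exp (-a) := by
    rw [← Real.exp_add]; ring_nf
  have e2 : Real.exp (-(2*b)) = Real.exp (-b) * Real.exp (-b) := by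
    rw [← Real.exp_add]; ring_nf
  have hlt : Real.exp (-b) < Real.exp (-a) := Real.exp_lt_exp.2 (by linarith)
  have hp : 0 < b * (1 - Real.exp (-a)) := by
    have : Real.exp (-a) < 1 := Real.exp_lt_one_iff.2 (by linarith)
    exact mul_pos hb (by linarith)
  rw [e1, e2]
  have h1 := mul_le_mul_of_nonneg_right hc2 (Real.exp_pos (-b)).le
  have h2 := mul_lt_mul_of_pos_left hlt hp
  linarith

lemma aux_lower (p : ℕ → ℝ) (hpos : ∀ j, 0 < p j) (hs : Summable p) (t : ℝ) (ht : 0 < t) :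
    t * phi p (2 * t) < Vpois p t := by
  have h := (aux_summable p hpos hs (2*t) (by linarith)).hasSum.mul_left t
  have key : ∀ j, t * (p j * Real.exp (-(2*t) * p j)) <
      Real.exp (-t * p j) - Real.exp (-(2 * t) * p j) := by
    intro j
    have hx : 0 < t * p j := mul_pos ht (hpos j)
    have e : Real.exp (-t * p j) = Real.exp (-(2*t) * p j) * Real.exp (t * p j) := by
      rw [← Real.exp_add]; ring_nf
    have h1 := Real.add_one_lt_exp hx.ne'
    have := mul_lt_mul_of_pos_left h1 (Real.exp_pos (-(2*t) * p j))
    rw [e]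
    linarith
  exact hasSum_lt (fun j => (key j).le) (key 0) h (aux_V p hpos hs t ht.le)

lemma aux_upper (p : ℕ → ℝ) (hpos : ∀ j, 0 < p j) (hs : Summable p) (t : ℝ) (ht : 0 < t) :
    Vpois p t < t * phi p t := by
  have h := (aux_summable p hpos hs t ht.le).hasSum.mul_left t
  have key : ∀ j, Real.exp (-t * p j) - Real.exp (-(2 * t) * p j) <
      t * (p j * Real.exp (-t * p j)) := by
    intro j
    have hx : 0 < t * p j := mul_pos ht (hpos j)
    have e : Real.exp (-(2*t) * p j) = Real.exp (-t * p j) * Real.exp (-(t * p j)) := by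
      rw [← Real.exp_add]; ring_nf
    have h1 := Real.add_one_lt_exp (neg_ne_zero.2 hx.ne')
    have := mul_lt_mul_of_pos_left h1 (Real.exp_pos (-t * p j))
    rw [e]
    linarith
  exact hasSum_lt (fun j => (key j).le) (key 0) (aux_V p hpos hs t ht.le) h

lemma aux_Vanti (p : ℕ → ℝ) (hpos : ∀ j, 0 < p j) (hs : Summable p) (s t : ℝ) (h0 : 0 < s)
    (hst : s < t) : s * Vpois p t < t * Vpois p s := by
  have key : ∀ j, s * (Real.exp (-t * p j) - Real.exp (-(2 * t) * p j)) <
      t * (Real.exp (-s * p j) - Real.exp (-(2 * s) * p j)) := by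
    intro j
    have := aux_key (mul_pos h0 (hpos j)) (mul_lt_mul_of_pos_right hst (hpos j))
    have hp := hpos j
    rw [show -t * p j = -(t * p j) by ring, show -(2*t) * p j = -(2*(t * p j)) by ring,
      show -s * p j = -(s * p j) by ring, show -(2*s) * p j = -(2*(s * p j)) by ring]
    refine lt_of_mul_lt_mul_left (a := p j) ?_ hp.le
    linarith
  exact hasSum_lt (fun j => (key j).le) (key 0)
    ((aux_V p hpos hs t (h0.trans hst).le).mul_left s) ((aux_V p hpos hs s h0.le).mul_left t)

lemma aux_cont (p : ℕ → ℝ) (hpos : ∀ j, 0 < p j) (hs : Summable p) :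
    ContinuousOn (phi p) (Set.Ici 0) := by
  refine continuousOn_tsum (u := p) (fun j => by fun_prop) hs ?_
  intro j t ht
  have ht : 0 ≤ t := ht
  have h1 : Real.exp (-t * p j) ≤ 1 := by
    apply Real.exp_le_one_iff.2
    have := mul_nonneg ht (hpos j).le
    linarith
  rw [Real.norm_of_nonneg (mul_nonneg (hpos j).le (Real.exp_pos _).le)]
  have := mul_le_mul_of_nonneg_left h1 (hpos j).le
  linarith

lemma aux_anti (p : ℕ → ℝ) (hpos : ∀ j, 0 < p j) (hs : Summable p) (s t : ℝ) (h0 : 0 ≤ s)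
    (hst : s ≤ t) : phi p t ≤ phi p s := by
  refine Summable.tsum_le_tsum (fun j => ?_) (aux_summable p hpos hs t (h0.trans hst))
    (aux_summable p hpos hs s h0)
  have := mul_le_mul_of_nonneg_right hst (hpos j).le
  exact mul_le_mul_of_nonneg_left (Real.exp_le_exp.2 (by linarith)) (hpos j).le

/-- There is a strictly increasing `τ` with `t < τ(t) < 2t` and
`V(t) = (t/τ(t)) Φ_1(τ(t))`, i.e. `Φ(2t) − Φ(t) = t φ(τ(t))`.
In particular `V(t) → ∞` iff `Φ_1(t) → ∞`. -/
theorem stmt_10 (p : ℕ → ℝ) (hpos : ∀ j, 0 < p j) (hmono : Antitone p)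
    (hsum : ∑' j, p j = 1) :
    (∃ τ : ℝ → ℝ, StrictMonoOn τ (Set.Ioi 0) ∧
      (∀ t : ℝ, 0 < t → t < τ t ∧ τ t < 2 * t) ∧
      (∀ t : ℝ, 0 < t → Vpois p t = t / τ t * Phi1 p (τ t)) ∧
      (∀ t : ℝ, 0 < t → Vpois p t = t * phi p (τ t))) ∧
    (Tendsto (Vpois p) atTop atTop ↔ Tendsto (Phi1 p) atTop atTop) := by
  have hs : Summable p := by
    by_contra h
    rw [tsum_eq_zero_of_not_summable h] at hsum
    exact zero_ne_one hsum
  constructor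
  · have ex : ∀ t : ℝ, ∃ x, 0 < t → (t < x ∧ x < 2 * t) ∧ Vpois p t = t * phi p x := by
      intro t
      by_cases ht : 0 < t
      · have hc : ContinuousOn (fun x => t * phi p x) (Set.Icc t (2*t)) :=
          continuousOn_const.mul ((aux_cont p hpos hs).mono
            (fun x hx => le_trans ht.le hx.1))
        obtain ⟨x, hx, hx2⟩ := intermediate_value_Ioo' (by linarith : t ≤ 2 * t) hc
          ⟨aux_lower p hpos hs t ht, aux_upper p hpos hs t ht⟩
        exact ⟨x, fun _ => ⟨hx, hx2.symm⟩⟩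
      · exact ⟨0, fun h => absurd h ht⟩
    choose τ hτ using ex
    refine ⟨τ, ?_, fun t ht => (hτ t ht).1, ?_, fun t ht => (hτ t ht).2⟩
    · intro s h0 t h1 hst
      have h0 : 0 < s := h0
      have h1 : 0 < t := h1
      by_contra hle
      push Not at hle
      have ha := aux_anti p hpos hs _ _ (h1.trans (hτ t h1).1.1).le hle
      have hv := aux_Vanti p hpos hs s t h0 hst
      rw [(hτ t h1).2, (hτ s h0).2] at hv
      have := mul_le_mul_of_nonneg_left ha (mul_pos h0 h1).le
      linarith
    · intro t ht
      have h1 : τ t ≠ 0 := (ht.trans (hτ t ht).1.1).ne'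
      rw [(hτ t ht).2]
      change t * phi p (τ t) = t / τ t * (τ t * phi p (τ t))
      field_simp
  · constructor
    · intro h
      refine tendsto_atTop_mono' _ ?_ h
      filter_upwards [eventually_gt_atTop 0] with t ht
      exact (aux_upper p hpos hs t ht).le
    · intro h
      have h2 : Tendsto (fun t : ℝ => (1/2) * Phi1 p (2 * t)) atTop atTop :=
        (h.comp (tendsto_id.const_mul_atTop (by norm_num : (0:ℝ) < 2))).const_mul_atTop
          (by norm_num : (0:ℝ) < 1/2)
      refine tendsto_atTop_mono' _ ?_ h2
      filter_upwards [eventually_gt_atTop 0] with t ht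
      have := aux_lower p hpos hs t ht
      have e : Phi1 p (2 * t) = 2 * t * phi p (2 * t) := rfl
      rw [e]
      linarith
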